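/- Let G be a finite simple graph and let (S,≤) be a well-quasi-order. Then the class of (S,≤)-labeled subdivisions of G is well-quasi-ordered by the label-respecting contraction relation. -/

import Mathlib

open SimpleGraph

namespace IMWQO

/-- `H` is an induced minor of `G`: there is a family of pairwise disjoint nonempty
connected subsets of `V(G)`, indexed by `V(H)`, such that distinct branch sets are
joined by an edge of `G` iff the corresponding vertices are adjacent in `H`. -/
def IsInducedMinor {α β : Type*} (H : SimpleGraph α) (G : SimpleGraph β) : Prop :=
  ∃ μ : α → Set β,
    (∀ a, (μ a).Nonempty) ∧
    (∀ a b, a ≠ b → Disjoint (μ a) (μ b)) ∧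
    (∀ a, (G.induce (μ a)).Connected) ∧
    (∀ a b, a ≠ b → ((∃ x ∈ μ a, ∃ y ∈ μ b, G.Adj x y) ↔ H.Adj a b))

/-- A bundled finite simple graph. -/
abbrev FinGraph := Σ n : ℕ, SimpleGraph (Fin n)

/-- The induced minor relation on bundled finite graphs. -/
def FinGraph.IM (H G : FinGraph) : Prop := IsInducedMinor H.2 G.2

/-- A class of finite graphs is well-quasi-ordered by the induced minor relation. -/
def WqoClass (P : FinGraph → Prop) : Prop :=
  ∀ f : ℕ → FinGraph, (∀ i, P (f i)) → ∃ i j, i < j ∧ FinGraph.IM (f i) (f j)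

/-- `K̂₄`: `K₄` (on vertices `0,1,2,3`) plus a vertex `4` adjacent to `0` and `1`. -/
def hatK4 : SimpleGraph (Fin 5) :=
  SimpleGraph.fromRel fun a b =>
    (a.val < 4 ∧ b.val < 4) ∨ (a.val = 4 ∧ (b.val = 0 ∨ b.val = 1))

/-- The gem: the path `0 - 1 - 2 - 3` plus a dominating vertex `4`. -/
def gem : SimpleGraph (Fin 5) :=
  SimpleGraph.fromRel fun a b =>
    (b.val = a.val + 1 ∧ b.val ≤ 3) ∨ a.val = 4

/-- The complete graph on four vertices. -/
def K4 : SimpleGraph (Fin 4) := ⊤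

/-- The prism, i.e. the Cartesian (box) product `K₃ □ K₂`. -/
def prism : SimpleGraph (Fin 3 × Fin 2) :=
  (⊤ : SimpleGraph (Fin 3)) □ (⊤ : SimpleGraph (Fin 2))

/-- The complete bipartite graph `K_{3,3}`. -/
def K33 : SimpleGraph (Fin 3 ⊕ Fin 3) := completeBipartiteGraph (Fin 3) (Fin 3)

/-- Subdivide the edge `{u,v}` of `G`, the new vertex being `Fin.last n`. -/
def subdivideEdge {n : ℕ} (G : SimpleGraph (Fin n)) (u v : Fin n) :
    SimpleGraph (Fin (n + 1)) :=
  SimpleGraph.fromRel fun a b =>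
    (∃ a' b' : Fin n, a = a'.castSucc ∧ b = b'.castSucc ∧ G.Adj a' b' ∧
      ¬(a' = u ∧ b' = v) ∧ ¬(a' = v ∧ b' = u))
    ∨ (a = Fin.last n ∧ (b = u.castSucc ∨ b = v.castSucc))

/-- One subdivision step on bundled graphs: the first graph is obtained from the
second one by subdividing one edge. -/
inductive SubdivStep : FinGraph → FinGraph → Prop
  | mk {n : ℕ} (G : SimpleGraph (Fin n)) (u v : Fin n) (h : G.Adj u v) :
      SubdivStep ⟨n + 1, subdivideEdge G u v⟩ ⟨n, G⟩

/-- `G` is (isomorphic to) a subdivision of `H`. -/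
def IsSubdivision {α β : Type*} (G : SimpleGraph α) (H : SimpleGraph β) : Prop :=
  ∃ A B : FinGraph, Nonempty (G ≃g A.2) ∧ Nonempty (H ≃g B.2) ∧
    Relation.ReflTransGen SubdivStep A B

/-- `G` contains a subdivision of `H` as a subgraph. -/
def ContainsSubdivAsSubgraph {α β : Type*} (G : SimpleGraph α) (H : SimpleGraph β) : Prop :=
  ∃ S : G.Subgraph, IsSubdivision S.coe H

/-- `G` has a proper `K₄`-subdivision: for some vertex `v`, `G - v` contains
a subdivision of `K₄` as a subgraph. -/
def HasProperK4Subdivision {α : Type*} (G : SimpleGraph α) : Prop :=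
  ∃ v : α, ContainsSubdivAsSubgraph (G.induce {u | u ≠ v}) K4

/-- `G` is 2-connected: at least 3 vertices, and removing any vertex leaves it connected. -/
def TwoConnected {α : Type*} [Fintype α] (G : SimpleGraph α) : Prop :=
  3 ≤ Fintype.card α ∧ ∀ v : α, (G.induce {u | u ≠ v}).Connected

/-- `G` is complete multipartite: two vertices are adjacent iff they lie in different
classes of some partition (equivalence relation). -/
def IsCompleteMultipartite {α : Type*} (G : SimpleGraph α) : Prop :=
  ∃ s : Setoid α, ∀ u v, G.Adj u v ↔ ¬ s.r u v

/-- `G` is a cograph: it has no induced path on four vertices. -/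
def IsCograph {α : Type*} (G : SimpleGraph α) : Prop :=
  ∀ f : Fin 4 → α, Function.Injective f →
    ¬ (∀ a b : Fin 4, G.Adj (f a) (f b) ↔ (pathGraph 4).Adj a b)

/-- `G` is a linear forest: acyclic with maximum degree at most 2,
i.e. a disjoint union of paths. -/
def IsLinearForest {α : Type*} (G : SimpleGraph α) : Prop :=
  G.IsAcyclic ∧ ∀ v, (G.neighborSet v).ncard ≤ 2

/-- The set `C` induces an (induced) cycle in `G`. -/
def InducesCycle {α : Type*} (G : SimpleGraph α) (C : Set α) : Prop :=
  ∃ n : ℕ, 3 ≤ n ∧ Nonempty ((G.induce C) ≃g cycleGraph n)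

/-- The set `S` induces a path in `G` all of whose internal vertices have degree two
in `G`. -/
def IsBasicPath {α : Type*} (G : SimpleGraph α) (S : Set α) : Prop :=
  ∃ (n : ℕ) (φ : (G.induce S) ≃g pathGraph n),
    ∀ v : S, (φ v).val ≠ 0 → (φ v).val ≠ n - 1 → (G.neighborSet v.val).ncard = 2

/-- The wheel with cycle `0, …, n-1` and center adjacent to the vertices of `T`. -/
def wheelGraph (n : ℕ) (T : Finset (Fin n)) : SimpleGraph (Fin n ⊕ Unit) :=
  SimpleGraph.fromRel fun a b =>
    (∃ x y : Fin n, a = Sum.inl x ∧ b = Sum.inl y ∧ (cycleGraph n).Adj x y)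
    ∨ (∃ x ∈ T, a = Sum.inr () ∧ b = Sum.inl x)

/-- `G` is a `k`-wheel: a cycle of order at least `max k 3` plus a center adjacent to
exactly `k` distinct vertices of the cycle. -/
def IsWheel {α : Type*} (k : ℕ) (G : SimpleGraph α) : Prop :=
  ∃ n : ℕ, 3 ≤ n ∧ k ≤ n ∧ ∃ T : Finset (Fin n), T.card = k ∧
    Nonempty (G ≃g wheelGraph n T)

/-- A 3-wheel subgraph of `G`: a cycle of `G` together with a center outside the cycle
joined to (at least) three distinct vertices of the cycle by edges of `G`. -/
structure ThreeWheelSub {α : Type*} (G : SimpleGraph α) where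
  base : α
  cyc : G.Walk base base
  cyc_isCycle : cyc.IsCycle
  center : α
  center_not_mem : center ∉ cyc.support
  spokes : Finset α
  spokes_card : spokes.card = 3
  spokes_sub : ∀ x ∈ spokes, x ∈ cyc.support
  spokes_adj : ∀ x ∈ spokes, G.Adj center x

/-- The number of vertices of a 3-wheel subgraph. -/
def ThreeWheelSub.order {α : Type*} [DecidableEq α] {G : SimpleGraph α}
    (W : ThreeWheelSub G) : ℕ :=
  W.cyc.support.toFinset.card + 1

/-- `G` has a cycle-multipartite decomposition. -/
def HasCycleMultipartiteDecomp {α : Type*} (G : SimpleGraph α) : Prop :=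
  ∃ C R : Set α, C ∪ R = Set.univ ∧ Disjoint C R ∧
    InducesCycle G C ∧ IsCompleteMultipartite (G.induce R) ∧
    ∀ u ∈ R, ∀ v ∈ R, ∀ c ∈ C, (G.Adj u c ↔ G.Adj v c)

/-- A bundled finite simple graph whose vertices are labeled by finite subsets of `S`. -/
structure LabGraph (S : Type*) where
  n : ℕ
  graph : SimpleGraph (Fin n)
  label : Fin n → Finset S

/-- The domination order on finite subsets of a quasi-order: `A ≤^P B` iff there is an
injection `φ : A → B` with `r a (φ a)` for all `a ∈ A`. -/
def FinsetLE {S : Type*} (r : S → S → Prop) (A B : Finset S) : Prop :=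
  ∃ φ : {x // x ∈ A} → {x // x ∈ B}, Function.Injective φ ∧ ∀ a, r a.val (φ a).val

/-- The union of the labels of the vertices in `A`. -/
noncomputable def labelUnion {S : Type*} {n : ℕ} (lab : Fin n → Finset S)
    (A : Finset (Fin n)) : Finset S :=
  letI := Classical.decEq S
  A.biUnion lab

/-- Label-respecting induced minor relation on labeled graphs. -/
def LabIM {S : Type*} (r : S → S → Prop) (H G : LabGraph S) : Prop :=
  ∃ μ : Fin H.n → Finset (Fin G.n),
    (∀ a, (μ a).Nonempty) ∧
    (∀ a b, a ≠ b → Disjoint (μ a) (μ b)) ∧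
    (∀ a, (G.graph.induce (↑(μ a) : Set (Fin G.n))).Connected) ∧
    (∀ a b, a ≠ b → ((∃ x ∈ μ a, ∃ y ∈ μ b, G.graph.Adj x y) ↔ H.graph.Adj a b)) ∧
    (∀ a, FinsetLE r (H.label a) (labelUnion G.label (μ a)))

/-- Label-respecting contraction relation on labeled graphs: an induced minor model
whose branch sets cover all vertices. -/
def LabContraction {S : Type*} (r : S → S → Prop) (H G : LabGraph S) : Prop :=
  ∃ μ : Fin H.n → Finset (Fin G.n),
    (∀ a, (μ a).Nonempty) ∧
    (∀ a b, a ≠ b → Disjoint (μ a) (μ b)) ∧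
    (∀ x : Fin G.n, ∃ a, x ∈ μ a) ∧
    (∀ a, (G.graph.induce (↑(μ a) : Set (Fin G.n))).Connected) ∧
    (∀ a b, a ≠ b → ((∃ x ∈ μ a, ∃ y ∈ μ b, G.graph.Adj x y) ↔ H.graph.Adj a b)) ∧
    (∀ a, FinsetLE r (H.label a) (labelUnion G.label (μ a)))

/-- Label-respecting induced subgraph relation on labeled graphs. -/
def LabISub {S : Type*} (r : S → S → Prop) (H G : LabGraph S) : Prop :=
  ∃ φ : Fin H.n → Fin G.n, Function.Injective φ ∧
    (∀ a b, H.graph.Adj a b ↔ G.graph.Adj (φ a) (φ b)) ∧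
    (∀ a, FinsetLE r (H.label a) (G.label (φ a)))

/-- A relation is a well-quasi-order: every infinite sequence contains a good pair. -/
def IsWqo {S : Type*} (r : S → S → Prop) : Prop :=
  ∀ g : ℕ → S, ∃ i j, i < j ∧ r (g i) (g j)


section Lists

variable {β γ : Type*}

/-- `x` and `y` occur consecutively, in this order, in the list. -/
def Consec (x y : β) : List β → Prop
  | a :: b :: l => (x = a ∧ y = b) ∨ Consec x y (b :: l)
  | _ => False

@[simp] theorem not_consec_singleton (x y a : β) : ¬ Consec x y [a] := fun h => h

@[simp] theorem consec_cons_cons (x y a b : β) (l : List β) :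
    Consec x y (a :: b :: l) ↔ (x = a ∧ y = b) ∨ Consec x y (b :: l) := Iff.rfl

theorem Consec.cons {x y : β} (a : β) {l : List β} (h : Consec x y l) : Consec x y (a :: l) := by
  cases l with
  | nil => exact h.elim
  | cons b l => exact Or.inr h

theorem Consec.exists_append {x y : β} {l : List β} (h : Consec x y l) :
    ∃ p q, l = p ++ x :: y :: q := by
  induction l with
  | nil => exact h.elim
  | cons a l ih =>
    cases l with
    | nil => exact h.elim
    | cons b l =>
      rcases h with ⟨rfl, rfl⟩ | h
      · exact ⟨[], l, rfl⟩
      · obtain ⟨p, q, hpq⟩ := ih h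
        exact ⟨a :: p, q, by rw [hpq]; rfl⟩

theorem Consec.mem {x y : β} {l : List β} (h : Consec x y l) : x ∈ l ∧ y ∈ l := by
  obtain ⟨p, q, rfl⟩ := h.exists_append
  simp

theorem Consec.not_swap {x y : β} {l : List β} (hl : l.Nodup) (h : Consec x y l) :
    ¬ Consec y x l := by
  induction l with
  | nil => exact h.elim
  | cons a l ih =>
    cases l with
    | nil => exact h.elim
    | cons b l =>
      have h1 := fun h' : Consec x y (b :: l) => h'.mem
      have h2 := fun h' : Consec y x (b :: l) => h'.mem
      rw [List.nodup_cons] at hl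
      rw [consec_cons_cons] at h ⊢
      grind

theorem consec_map {f : β → γ} (hf : Function.Injective f) (x y : β) (l : List β) :
    Consec (f x) (f y) (l.map f) ↔ Consec x y l := by
  induction l with
  | nil => rfl
  | cons a l ih =>
    cases l with
    | nil => rfl
    | cons b l =>
      simp only [List.map_cons, consec_cons_cons, hf.eq_iff] at ih ⊢
      rw [ih]

theorem consec_insert {u v w : β} {p q : List β} (hl : (p ++ u :: v :: q).Nodup)
    (x y : β) :
    Consec x y (p ++ u :: w :: v :: q) ↔
      (Consec x y (p ++ u :: v :: q) ∧ ¬ (x = u ∧ y = v)) ∨ (x = u ∧ y = w) ∨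
        (x = w ∧ y = v) := by
  induction p with
  | nil =>
    have h1 := fun h' : Consec x y (v :: q) => h'.mem
    simp only [List.nil_append, consec_cons_cons, List.nodup_cons] at hl ⊢
    grind
  | cons a p ih =>
    rw [List.cons_append, List.nodup_cons] at hl
    have ih := ih hl.2
    cases p with
    | nil =>
      simp only [List.nil_append, List.cons_append, consec_cons_cons] at hl ih ⊢
      grind
    | cons b p =>
      simp only [List.cons_append, consec_cons_cons] at hl ih ⊢
      grind

/-- A new element can be inserted between two consecutive elements of `a :: l ++ [b]` by changing
only the inner part `l`. -/
theorem exists_insert_inner {a b u v : β} (w : β) {l p q : List β}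
    (h : a :: l ++ [b] = p ++ u :: v :: q) :
    ∃ l', a :: l' ++ [b] = p ++ u :: w :: v :: q ∧ l'.Perm (w :: l) := by
  cases p with
  | nil =>
    simp only [List.nil_append, List.cons_append, List.cons.injEq] at h
    exact ⟨w :: l, by simp [h.1, h.2], List.Perm.refl _⟩
  | cons c p =>
    simp only [List.cons_append, List.cons.injEq] at h
    obtain ⟨rfl, h⟩ := h
    rcases List.eq_nil_or_concat q with rfl | ⟨q, z, rfl⟩
    · have h' : l ++ [b] = (p ++ [u]) ++ [v] := by simpa using h
      obtain ⟨rfl, h⟩ := List.append_inj' h' rfl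
      refine ⟨p ++ [u] ++ [w], by simpa using h, ?_⟩
      exact List.perm_append_singleton _ _
    · have h' : l ++ [b] = (p ++ u :: v :: q) ++ [z] := by simpa using h
      obtain ⟨rfl, h⟩ := List.append_inj' h' rfl
      refine ⟨p ++ u :: w :: v :: q, by simpa using h, ?_⟩
      have := List.perm_middle (a := w) (l₁ := p ++ [u]) (l₂ := v :: q)
      simpa using this

/-- `Collapse c l l'` says that `l` arises from `l'.map c` by merging runs of equal
consecutive entries (not necessarily all of them). -/
inductive Collapse (c : γ → β) : List β → List γ → Prop
  | single {y : γ} {b : β} (hy : c y = b) : Collapse c [b] [y]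
  | merge {x y : γ} {b : β} {l : List β} {l' : List γ} (hx : c x = b) (hy : c y = b) :
      Collapse c (b :: l) (y :: l') → Collapse c (b :: l) (x :: y :: l')
  | keep {x y : γ} {a b : β} {l : List β} {l' : List γ} (hx : c x = a) (hy : c y = b) :
      Collapse c (b :: l) (y :: l') → Collapse c (a :: b :: l) (x :: y :: l')

namespace Collapse

variable {c : γ → β} {l : List β} {l' : List γ}

theorem congr {d : γ → β} (h : Collapse c l l') (hcd : ∀ y ∈ l', d y = c y) :
    Collapse d l l' := by
  induction h with
  | single hy => exact .single ((hcd _ (by simp)).trans hy)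
  | merge hx hy _ ih =>
    exact .merge ((hcd _ (by simp)).trans hx) ((hcd _ (by simp)).trans hy)
      (ih fun z hz => hcd z (List.mem_cons_of_mem _ hz))
  | keep hx hy _ ih =>
    exact .keep ((hcd _ (by simp)).trans hx) ((hcd _ (by simp)).trans hy)
      (ih fun z hz => hcd z (List.mem_cons_of_mem _ hz))

theorem mem (h : Collapse c l l') : ∀ y ∈ l', c y ∈ l := by
  induction h with
  | single hy => simp [hy]
  | merge hx _ _ ih => grind
  | keep hx _ _ ih => grind

theorem eq_or_consec (h : Collapse c l l') {y z : γ} (hyz : Consec y z l') :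
    c y = c z ∨ Consec (c y) (c z) l := by
  induction h with
  | single _ => exact hyz.elim
  | merge hx hy _ ih =>
    rcases hyz with ⟨rfl, rfl⟩ | hyz
    · exact Or.inl (hx.trans hy.symm)
    · exact ih hyz
  | keep hx hy _ ih =>
    rcases hyz with ⟨rfl, rfl⟩ | hyz
    · exact Or.inr (Or.inl ⟨hx, hy⟩)
    · exact (ih hyz).imp_right (Consec.cons _)

theorem exists_consec (h : Collapse c l l') {a b : β} (hab : Consec a b l) :
    ∃ y z, Consec y z l' ∧ c y = a ∧ c z = b := by
  induction h with
  | single _ => exact hab.elim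
  | merge _ _ _ ih =>
    obtain ⟨y, z, hyz, h⟩ := ih hab
    exact ⟨y, z, hyz.cons _, h⟩
  | @keep x y _ _ _ _ hx hy _ ih =>
    rcases hab with ⟨rfl, rfl⟩ | hab
    · exact ⟨x, y, Or.inl ⟨rfl, rfl⟩, hx, hy⟩
    · obtain ⟨y, z, hyz, h⟩ := ih hab
      exact ⟨y, z, hyz.cons _, h⟩

/-- Two elements of `l'` with the same image are joined by a run with constant image. -/
theorem reflTransGen (h : Collapse c l l') (hl : l.Nodup) {y z : γ} (hy : y ∈ l') (hz : z ∈ l')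
    (hyz : c y = c z) :
    Relation.ReflTransGen (fun a b => (Consec a b l' ∨ Consec b a l') ∧ c a = c b) y z := by
  induction h generalizing y z with
  | single _ =>
    rw [List.mem_singleton] at hy hz
    rw [hy, hz]
  | @merge x w b l l' hx hw _ ih =>
    have hxw := hx.trans hw.symm
    have lift : ∀ {s t}, s ∈ w :: l' → t ∈ w :: l' → c s = c t → Relation.ReflTransGen
        (fun a b => (Consec a b (x :: w :: l') ∨ Consec b a (x :: w :: l')) ∧ c a = c b) s t :=
      fun hs ht hst => Relation.ReflTransGen.mono
        (fun _ _ h => ⟨h.1.imp (Consec.cons _) (Consec.cons _), h.2⟩) _ _ (ih hl hs ht hst)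
    rcases List.mem_cons.1 hy with rfl | hy' <;> rcases List.mem_cons.1 hz with rfl | hz'
    · exact .refl
    · exact .head ⟨Or.inl (Or.inl ⟨rfl, rfl⟩), hxw⟩ (lift (by simp) hz' (hxw.symm.trans hyz))
    · exact .tail (lift hy' (by simp) (hyz.trans hxw)) ⟨Or.inr (Or.inl ⟨rfl, rfl⟩), hxw.symm⟩
    · exact lift hy' hz' hyz
  | @keep x w a b l l' hx _ h ih =>
    rw [List.nodup_cons] at hl
    rcases List.mem_cons.1 hy with hy | hy <;> rcases List.mem_cons.1 hz with hz | hz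
    · rw [hy, hz]
    · exact (hl.1 (by rw [← hx, ← hy, hyz]; exact h.mem z hz)).elim
    · exact (hl.1 (by rw [← hx, ← hz, ← hyz]; exact h.mem y hy)).elim
    · exact Relation.ReflTransGen.mono
        (fun _ _ h => ⟨h.1.imp (Consec.cons _) (Consec.cons _), h.2⟩) _ _ (ih hl.2 hy hz hyz)

end Collapse

/-- An embedding of `l` into `l'` yields a collapse of `s' :: l' ++ [t']` onto `s :: l ++ [t]`:
the elements skipped by the embedding are merged with the preceding ones. -/
theorem exists_collapse {R : β → γ → Prop} {l : List β} {l' : List γ}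
    (h : List.SublistForall₂ R l l') {s t : β} {s' t' : γ} (hnd : (s' :: l' ++ [t']).Nodup) :
    ∃ c : γ → β, c s' = s ∧ c t' = t ∧ Collapse c (s :: l ++ [t]) (s' :: l' ++ [t']) ∧
      ∀ x ∈ l, ∃ y ∈ l', c y = x ∧ R x y := by
  classical
  have hupdate : ∀ {l₁ : List γ} {s₁ : γ} (s₀ : β) (c : γ → β), (s₁ :: l₁ ++ [t']).Nodup →
      ∃ d : γ → β, d s₁ = s₀ ∧ ∀ y ∈ l₁ ++ [t'], d y = c y := by
    intro l₁ s₁ s₀ c hnd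
    refine ⟨Function.update c s₁ s₀, by simp, fun y hy => Function.update_of_ne ?_ _ _⟩
    rintro rfl
    exact (List.nodup_cons.1 hnd).1 hy
  have nil_case : ∀ (l' : List γ) (s' : γ) (s : β), (s' :: l' ++ [t']).Nodup →
      ∃ c : γ → β, c s' = s ∧ c t' = t ∧ Collapse c [s, t] (s' :: l' ++ [t']) := by
    intro l'
    induction l' with
    | nil =>
      intro s' s hnd
      obtain ⟨d, hd, hd'⟩ := hupdate s (fun _ => t) hnd
      have ht := hd' t' (by simp)
      exact ⟨d, hd, ht, .keep hd ht (.single ht)⟩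
    | cons b l' ih =>
      intro s' s hnd
      obtain ⟨c, hb, ht, hc⟩ := ih b s (List.nodup_cons.1 hnd).2
      obtain ⟨d, hd, hd'⟩ := hupdate s c hnd
      exact ⟨d, hd, (hd' t' (by simp)).trans ht,
        .merge hd ((hd' b (by simp)).trans hb) (hc.congr hd')⟩
  induction h generalizing s s' with
  | nil =>
    obtain ⟨c, h1, h2, h3⟩ := nil_case _ _ _ hnd
    exact ⟨c, h1, h2, h3, by simp⟩
  | @cons a b l l' hab _ ih =>
    obtain ⟨c, hb, ht, hc, hR⟩ := ih (s := a) (s' := b) (List.nodup_cons.1 hnd).2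
    obtain ⟨d, hd, hd'⟩ := hupdate s c hnd
    have hb' := (hd' b (by simp)).trans hb
    refine ⟨d, hd, (hd' t' (by simp)).trans ht, .keep hd hb' (hc.congr hd'), ?_⟩
    intro x hx
    rcases List.mem_cons.1 hx with rfl | hx
    · exact ⟨b, by simp, hb', hab⟩
    · obtain ⟨y, hy, hyx, hxy⟩ := hR x hx
      exact ⟨y, by simp [hy], (hd' y (by simp [hy])).trans hyx, hxy⟩
  | @cons_right b l l' _ ih =>
    obtain ⟨c, hb, ht, hc, hR⟩ := ih (s := s) (s' := b) (List.nodup_cons.1 hnd).2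
    obtain ⟨d, hd, hd'⟩ := hupdate s c hnd
    refine ⟨d, hd, (hd' t' (by simp)).trans ht,
      .merge hd ((hd' b (by simp)).trans hb) (hc.congr hd'), ?_⟩
    intro x hx
    obtain ⟨y, hy, hyx, hxy⟩ := hR x hx
    exact ⟨y, by simp [hy], (hd' y (by simp [hy])).trans hyx, hxy⟩

/-- An embedding between duplicate-free lists is induced by a function that is injective on the
first list. -/
theorem exists_injOn_of_sublistForall₂ {R : β → γ → Prop} [Nonempty γ] {l : List β} {l' : List γ}
    (h : List.SublistForall₂ R l l') (hl : l.Nodup) (hl' : l'.Nodup) :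
    ∃ φ : β → γ, Set.InjOn φ {x | x ∈ l} ∧ ∀ x ∈ l, φ x ∈ l' ∧ R x (φ x) := by
  classical
  induction h with
  | nil => exact ⟨fun _ => Classical.arbitrary γ, by simp, by simp⟩
  | @cons a b l l' hab _ ih =>
    rw [List.nodup_cons] at hl hl'
    obtain ⟨φ, hinj, hφ⟩ := ih hl.2 hl'.2
    refine ⟨Function.update φ a b, ?_, ?_⟩
    · intro x hx y hy hxy
      simp only [Set.mem_ofPred_eq, List.mem_cons, Function.update_apply] at hx hy hxy
      have := @hinj x
      grind
    · intro x hx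
      simp only [List.mem_cons, Function.update_apply] at hx ⊢
      grind
  | @cons_right b l l' _ ih =>
    obtain ⟨φ, hinj, hφ⟩ := ih hl (List.nodup_cons.1 hl').2
    exact ⟨φ, hinj, fun x hx => ⟨List.mem_cons_of_mem _ (hφ x hx).1, (hφ x hx).2⟩⟩

end Lists

section Models

variable {α E β γ : Type*}

/-- A presentation of the graph `H` as a subdivision of the graph with vertex set `α` and edge
set `E`, the edge `e` joining `src e` to `tgt e`: the edge `e` is replaced by a path with list
of inner vertices `inner e`. -/
structure SubdivModel (src tgt : E → α) (H : SimpleGraph β) where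
  base : α → β
  inner : E → List β
  base_injective : Function.Injective base
  nodup_inner : ∀ e, (inner e).Nodup
  eq_of_mem_inner : ∀ {e e' x}, x ∈ inner e → x ∈ inner e' → e = e'
  base_notMem_inner : ∀ a e, base a ∉ inner e
  cover : ∀ x, (∃ a, x = base a) ∨ ∃ e, x ∈ inner e
  adj_iff : ∀ x y, H.Adj x y ↔
    ∃ e, Consec x y (base (src e) :: inner e ++ [base (tgt e)]) ∨
      Consec y x (base (src e) :: inner e ++ [base (tgt e)])

namespace SubdivModel

variable {src tgt : E → α} {H : SimpleGraph β} {K : SimpleGraph γ}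

/-- The path replacing an edge, including its ends. -/
def path (M : SubdivModel src tgt H) (e : E) : List β :=
  M.base (src e) :: M.inner e ++ [M.base (tgt e)]

theorem mem_path (M : SubdivModel src tgt H) {e : E} {x : β} :
    x ∈ M.path e ↔ x = M.base (src e) ∨ x ∈ M.inner e ∨ x = M.base (tgt e) := by
  simp [path]

theorem nodup_path (M : SubdivModel src tgt H) (hne : ∀ e, src e ≠ tgt e) (e : E) :
    (M.path e).Nodup := by
  have h1 := M.nodup_inner e
  have h2 := M.base_notMem_inner (src e) e
  have h3 := M.base_notMem_inner (tgt e) e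
  have h4 := M.base_injective.ne (hne e)
  simp only [path, List.cons_append, List.nodup_cons, List.nodup_append, List.mem_append,
    List.mem_singleton]
  grind

theorem base_mem_path (M : SubdivModel src tgt H) {e : E} {a : α} (h : M.base a ∈ M.path e) :
    a = src e ∨ a = tgt e := by
  rcases M.mem_path.1 h with h | h | h
  · exact Or.inl (M.base_injective h)
  · exact (M.base_notMem_inner _ _ h).elim
  · exact Or.inr (M.base_injective h)

/-- Paths of different edges share at most one vertex, provided there are no parallel edges. -/
theorem eq_of_mem_path (M : SubdivModel src tgt H)
    (hE : ∀ e e', (src e = src e' ∧ tgt e = tgt e') ∨ (src e = tgt e' ∧ tgt e = src e') → e = e')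
    {e e' : E} {x y : β} (hxy : x ≠ y) (hx : x ∈ M.path e) (hy : y ∈ M.path e)
    (hx' : x ∈ M.path e') (hy' : y ∈ M.path e') : e = e' := by
  by_contra hne
  have key : ∀ {z}, z ∈ M.path e → z ∈ M.path e' → ∃ a, z = M.base a := by
    intro z hz hz'
    rw [mem_path] at hz hz'
    rcases hz with hz | hz | hz
    · exact ⟨_, hz⟩
    · rcases hz' with hz' | hz' | hz'
      · exact ⟨_, hz'⟩
      · exact (hne (M.eq_of_mem_inner hz hz')).elim
      · exact ⟨_, hz'⟩
    · exact ⟨_, hz⟩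
  obtain ⟨a, rfl⟩ := key hx hx'
  obtain ⟨b, rfl⟩ := key hy hy'
  have hab : a ≠ b := fun h => hxy (by rw [h])
  have h1 := M.base_mem_path hx
  have h2 := M.base_mem_path hx'
  have h3 := M.base_mem_path hy
  have h4 := M.base_mem_path hy'
  have h5 := hE e e'
  grind

/-- Transport of a presentation along an isomorphism. -/
def map (M : SubdivModel src tgt H) (φ : H ≃g K) : SubdivModel src tgt K where
  base a := φ (M.base a)
  inner e := (M.inner e).map φ
  base_injective := φ.injective.comp M.base_injective
  nodup_inner e := (M.nodup_inner e).map φ.injective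
  eq_of_mem_inner {e e' x} h h' := by
    obtain ⟨y, hy, rfl⟩ := List.mem_map.1 h
    exact M.eq_of_mem_inner hy ((List.mem_map_of_injective φ.injective).1 h')
  base_notMem_inner a e h :=
    M.base_notMem_inner a e ((List.mem_map_of_injective φ.injective).1 h)
  cover x := by
    obtain ⟨y, rfl⟩ := φ.surjective x
    rcases M.cover y with ⟨a, rfl⟩ | ⟨e, he⟩
    · exact Or.inl ⟨a, rfl⟩
    · exact Or.inr ⟨e, List.mem_map_of_mem he⟩
  adj_iff x y := by
    obtain ⟨x, rfl⟩ := φ.surjective x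
    obtain ⟨y, rfl⟩ := φ.surjective y
    rw [φ.map_adj_iff, M.adj_iff]
    refine exists_congr fun e => ?_
    have h := fun x y => consec_map φ.injective x y (M.path e)
    simp only [path, List.map_append, List.map_cons, List.map_nil] at h
    rw [h, h]

/-- Every graph is a subdivision of itself. -/
def refl {G : SimpleGraph α}
    (hG : ∀ a b, G.Adj a b ↔ ∃ e, (src e = a ∧ tgt e = b) ∨ (src e = b ∧ tgt e = a)) :
    SubdivModel src tgt G where
  base := id
  inner _ := []
  base_injective := Function.injective_id
  nodup_inner _ := List.nodup_nil
  eq_of_mem_inner h := by simp at h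
  base_notMem_inner _ _ := by simp
  cover x := Or.inl ⟨x, rfl⟩
  adj_iff x y := by
    rw [hG]
    refine exists_congr fun e => ?_
    simp [eq_comm]

/-- If `K` arises from `H` by subdividing an edge of `H` with the new vertex `w`, then a
presentation of `H` gives one of `K`. -/
theorem insert (M : SubdivModel src tgt H) (hne : ∀ e, src e ≠ tgt e)
    (hE : ∀ e e', (src e = src e' ∧ tgt e = tgt e') ∨ (src e = tgt e' ∧ tgt e = src e') → e = e')
    {u v : β} (huv : H.Adj u v) {ι : β → γ} (hι : Function.Injective ι) {w : γ}
    (hw : ∀ x, ι x ≠ w) (hcov : ∀ z, z = w ∨ ∃ x, z = ι x)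
    (hadj : ∀ x y, K.Adj (ι x) (ι y) ↔ H.Adj x y ∧ ¬ (x = u ∧ y = v) ∧ ¬ (x = v ∧ y = u))
    (hadj' : ∀ x, K.Adj w (ι x) ↔ x = u ∨ x = v) : Nonempty (SubdivModel src tgt K) := by
  classical
  obtain ⟨e₀, he₀⟩ := (M.adj_iff u v).1 huv
  wlog h₀ : Consec u v (M.path e₀) generalizing u v
  · refine this huv.symm (fun x y => ?_) (fun x => ?_) (he₀.symm) (he₀.resolve_left h₀)
    · rw [hadj]
      tauto
    · rw [hadj', or_comm]
  have hnd := M.nodup_path hne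
  obtain ⟨p, q, hpq⟩ := h₀.exists_append
  have hpq' : ι (M.base (src e₀)) :: (M.inner e₀).map ι ++ [ι (M.base (tgt e₀))]
      = p.map ι ++ ι u :: ι v :: q.map ι := by
    simpa [path] using congrArg (List.map ι) hpq
  obtain ⟨l, hl, hperm⟩ := exists_insert_inner w hpq'
  have hwmem : ∀ l : List β, w ∉ l.map ι := fun l h => by
    obtain ⟨x, -, hx⟩ := List.mem_map.1 h
    exact hw x hx
  let inner' : E → List γ := fun e => if e = e₀ then l else (M.inner e).map ι
  have hmem : ∀ x e, ι x ∈ inner' e ↔ x ∈ M.inner e := by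
    intro x e
    by_cases he : e = e₀
    · subst he
      simp [inner', hperm.mem_iff, hw, hι.eq_iff]
    · simp [inner', he, hι.eq_iff]
  have hmem' : ∀ e, w ∈ inner' e ↔ e = e₀ := by
    intro e
    by_cases he : e = e₀
    · simp [inner', he, hperm.mem_iff]
    · simp only [inner', he, if_false, iff_false]
      exact hwmem _
  have hmap : (M.path e₀).map ι = p.map ι ++ ι u :: ι v :: q.map ι := by
    rw [hpq]
    simp
  have hpath₀ : ∀ x y, Consec x y (ι (M.base (src e₀)) :: l ++ [ι (M.base (tgt e₀))]) ↔
      (Consec x y ((M.path e₀).map ι) ∧ ¬ (x = ι u ∧ y = ι v)) ∨ (x = ι u ∧ y = w) ∨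
        (x = w ∧ y = ι v) := by
    intro x y
    have := (hnd e₀).map hι
    rw [hmap] at this ⊢
    rw [hl, consec_insert this]
  have hpath : ∀ e x y, Consec x y (ι (M.base (src e)) :: inner' e ++ [ι (M.base (tgt e))]) ↔
      (Consec x y ((M.path e).map ι) ∧ ¬ (x = ι u ∧ y = ι v)) ∨
        e = e₀ ∧ ((x = ι u ∧ y = w) ∨ (x = w ∧ y = ι v)) := by
    intro e x y
    by_cases he : e = e₀
    · subst he
      simp only [inner', if_true, hpath₀, true_and]
    · have h1 : ι (M.base (src e)) :: (M.inner e).map ι ++ [ι (M.base (tgt e))] =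
          (M.path e).map ι := by simp [path]
      simp only [inner', he, if_false, h1, false_and, or_false, iff_self_and]
      rintro h ⟨rfl, rfl⟩
      rw [consec_map hι] at h
      exact he (M.eq_of_mem_path hE huv.ne h.mem.1 h.mem.2 h₀.mem.1 h₀.mem.2)
  refine ⟨⟨ι ∘ M.base, inner', hι.comp M.base_injective, ?_, ?_, ?_, ?_, ?_⟩⟩
  · intro e
    by_cases he : e = e₀
    · simp only [inner', he, if_true]
      rw [hperm.nodup_iff, List.nodup_cons]
      exact ⟨hwmem _, (M.nodup_inner e₀).map hι⟩
    · simp only [inner', he, if_false]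
      exact (M.nodup_inner e).map hι
  · intro e e' x h h'
    rcases hcov x with rfl | ⟨x, rfl⟩
    · rw [hmem'] at h h'
      rw [h, h']
    · rw [hmem] at h h'
      exact M.eq_of_mem_inner h h'
  · intro a e h
    exact M.base_notMem_inner a e ((hmem _ _).1 h)
  · intro x
    rcases hcov x with rfl | ⟨x, rfl⟩
    · exact Or.inr ⟨e₀, (hmem' _).2 rfl⟩
    · rcases M.cover x with ⟨a, rfl⟩ | ⟨e, he⟩
      · exact Or.inl ⟨a, rfl⟩
      · exact Or.inr ⟨e, (hmem _ _).2 he⟩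
  · intro x y
    simp only [Function.comp_apply, hpath]
    have hw₁ : ∀ e z, ¬ Consec w z ((M.path e).map ι) := fun e z h => hwmem _ h.mem.1
    have hw₂ : ∀ e z, ¬ Consec z w ((M.path e).map ι) := fun e z h => hwmem _ h.mem.2
    have hw' := fun x => (hw x).symm
    rcases hcov x with rfl | ⟨x, rfl⟩ <;> rcases hcov y with rfl | ⟨y, rfl⟩
    · simp [hw₁, hw']
    · simp [hw₁, hw₂, hw, hw', hadj', hι.eq_iff, exists_or, or_comm]
    · rw [K.adj_comm]
      simp [hw₁, hw₂, hw, hw', hadj', hι.eq_iff, exists_or]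
    · simp only [hadj, hι.eq_iff, hw, consec_map hι, and_false, false_and, or_false]
      rw [M.adj_iff]
      constructor
      · rintro ⟨⟨e, he⟩, h1, h2⟩
        exact ⟨e, he.imp (fun h => ⟨h, h1⟩) (fun h => ⟨h, fun h' => h2 h'.symm⟩)⟩
      · rintro ⟨e, he⟩
        have hne : ¬ Consec v u (M.path e) := by
          intro h
          have : e = e₀ := M.eq_of_mem_path hE huv.ne h.mem.2 h.mem.1 h₀.mem.1 h₀.mem.2
          subst this
          exact h₀.not_swap (hnd e) h
        refine ⟨⟨e, he.imp And.left And.left⟩, ?_, ?_⟩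
        · rintro ⟨rfl, rfl⟩
          exact he.elim (fun h => h.2 ⟨rfl, rfl⟩) (fun h => hne h.1)
        · rintro ⟨rfl, rfl⟩
          exact he.elim (fun h => hne h.1) (fun h => h.2 ⟨rfl, rfl⟩)

theorem of_isSubdivision {G : SimpleGraph α} (hne : ∀ e, src e ≠ tgt e)
    (hE : ∀ e e', (src e = src e' ∧ tgt e = tgt e') ∨ (src e = tgt e' ∧ tgt e = src e') → e = e')
    (hG : ∀ a b, G.Adj a b ↔ ∃ e, (src e = a ∧ tgt e = b) ∨ (src e = b ∧ tgt e = a))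
    (h : IsSubdivision H G) : Nonempty (SubdivModel src tgt H) := by
  obtain ⟨A, B, ⟨φ⟩, ⟨ψ⟩, hAB⟩ := h
  suffices Nonempty (SubdivModel src tgt A.2) from this.map fun M => M.map φ.symm
  clear φ
  induction hAB using Relation.ReflTransGen.head_induction_on with
  | refl => exact ⟨(refl hG).map ψ⟩
  | head hstep _ ih =>
    obtain ⟨H', u, v, huv⟩ := hstep
    obtain ⟨M⟩ := ih
    refine M.insert hne hE huv (Fin.castSucc_injective _) (w := Fin.last _) Fin.castSucc_ne_last
      (fun z => ?_) (fun x y => ?_) (fun x => ?_)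
    · induction z using Fin.lastCases with
      | last => exact Or.inl rfl
      | cast x => exact Or.inr ⟨x, rfl⟩
    · have h := fun x y (h : H'.Adj x y) => h.ne
      have h' := H'.adj_comm x y
      simp only [subdivideEdge, SimpleGraph.fromRel_adj, ne_eq, Fin.castSucc_inj,
        Fin.castSucc_ne_last, false_and, or_false]
      grind
    · have h {m : ℕ} (z : Fin m) := (Fin.castSucc_ne_last z).symm
      simp [subdivideEdge, SimpleGraph.fromRel_adj, h]

end SubdivModel

/-- A step-by-step connection within a fiber of `c` gives reachability in that fiber. -/
theorem reachable_induce_of_reflTransGen {K : SimpleGraph γ} {c : γ → β} {s : Set γ} {x : β}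
    (hs : ∀ y, y ∈ s ↔ c y = x) {y z : γ}
    (h : Relation.ReflTransGen (fun a b => K.Adj a b ∧ c a = c b) y z) (hy : y ∈ s) (hz : z ∈ s) :
    (K.induce s).Reachable ⟨y, hy⟩ ⟨z, hz⟩ := by
  induction h using Relation.ReflTransGen.head_induction_on with
  | refl => exact SimpleGraph.Reachable.refl _
  | @head y w hyw _ ih =>
    have hw : w ∈ s := (hs w).2 (hyw.2 ▸ (hs y).1 hy)
    have hadj : (K.induce s).Adj ⟨y, hy⟩ ⟨w, hw⟩ := hyw.1
    exact hadj.reachable.trans (ih hw)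

theorem FinsetLE.labelUnion {S : Type*} {r : S → S → Prop} {A : Finset S} {n : ℕ}
    {lab : Fin n → Finset S} {y : Fin n} {B : Finset (Fin n)} (h : FinsetLE r A (lab y))
    (hy : y ∈ B) : FinsetLE r A (labelUnion lab B) := by
  classical
  obtain ⟨φ, hinj, hφ⟩ := h
  have hsub : ∀ s ∈ lab y, s ∈ IMWQO.labelUnion lab B := by
    intro s hs
    simp only [IMWQO.labelUnion, Finset.mem_biUnion]
    exact ⟨y, hy, hs⟩
  refine ⟨fun a => ⟨(φ a).1, hsub _ (φ a).2⟩, fun a b hab => hinj (Subtype.ext ?_), hφ⟩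
  simpa using hab

theorem finsetLE_of_sublistForall₂ {S : Type*} {r : S → S → Prop} {A B : Finset S}
    (h : List.SublistForall₂ r A.toList B.toList) : FinsetLE r A B := by
  rcases A.eq_empty_or_nonempty with rfl | ⟨a, -⟩
  · exact ⟨fun a => (Finset.notMem_empty _ a.2).elim,
      fun a => (Finset.notMem_empty _ a.2).elim, fun a => (Finset.notMem_empty _ a.2).elim⟩
  have : Nonempty S := ⟨a⟩
  obtain ⟨φ, hinj, hφ⟩ := exists_injOn_of_sublistForall₂ h A.nodup_toList B.nodup_toList
  simp only [Finset.mem_toList] at hinj hφ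
  exact ⟨fun a => ⟨φ a, (hφ a a.2).1⟩,
    fun a b hab => Subtype.ext (hinj a.2 b.2 (congrArg Subtype.val hab)), fun a => (hφ a a.2).2⟩

/-- If the label words along the edges of one labeled subdivision embed into those of another,
and the labels of the branch vertices are dominated, then the former is a contraction of the
latter. -/
theorem SubdivModel.labContraction {src tgt : E → α} {S : Type*} {r : S → S → Prop}
    {A B : LabGraph S} (M : SubdivModel src tgt A.graph) (N : SubdivModel src tgt B.graph)
    (hne : ∀ e, src e ≠ tgt e)
    (hbase : ∀ a, FinsetLE r (A.label (M.base a)) (B.label (N.base a)))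
    (hinner : ∀ e, List.SublistForall₂ (fun x y => FinsetLE r (A.label x) (B.label y))
      (M.inner e) (N.inner e)) : LabContraction r A B := by
  classical
  have hcol := fun e => exists_collapse (hinner e) (s := M.base (src e)) (t := M.base (tgt e))
    (N.nodup_path hne e)
  choose d hsrc htgt hd hdR using hcol
  have hc : ∀ y, ∃ x, (∀ a, y = N.base a → x = M.base a) ∧ ∀ e, y ∈ N.inner e → x = d e y := by
    intro y
    rcases N.cover y with ⟨a, rfl⟩ | ⟨e, he⟩
    · exact ⟨M.base a, fun b hb => by rw [N.base_injective hb],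
        fun e he => (N.base_notMem_inner _ _ he).elim⟩
    · refine ⟨d e y, fun a ha => ?_, fun e' he' => by rw [N.eq_of_mem_inner he he']⟩
      exact (N.base_notMem_inner a e (ha ▸ he)).elim
  choose c hcbase hcinner using hc
  replace hcbase : ∀ a, c (N.base a) = M.base a := fun a => hcbase _ a rfl
  have hcd : ∀ e, ∀ y ∈ N.path e, c y = d e y := by
    intro e y hy
    rcases N.mem_path.1 hy with rfl | hy | rfl
    · rw [hcbase, hsrc]
    · exact hcinner y e hy
    · rw [hcbase, htgt]
  have hcol : ∀ e, Collapse c (M.path e) (N.path e) := fun e => (hd e).congr (hcd e)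
  have hMadj : ∀ x y, A.graph.Adj x y ↔ ∃ e, Consec x y (M.path e) ∨ Consec y x (M.path e) :=
    M.adj_iff
  have hNadj : ∀ x y, B.graph.Adj x y ↔ ∃ e, Consec x y (N.path e) ∨ Consec y x (N.path e) :=
    N.adj_iff
  have hφ : ∀ x, ∃ y, c y = x ∧ FinsetLE r (A.label x) (B.label y) ∧
      (∀ e, x ∈ M.path e → y ∈ N.path e) ∧ ∀ a, x = M.base a → y = N.base a := by
    intro x
    rcases M.cover x with ⟨a, rfl⟩ | ⟨e, he⟩
    · refine ⟨N.base a, hcbase a, hbase a, fun e he => ?_,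
        fun b hb => by rw [M.base_injective hb]⟩
      rcases M.base_mem_path he with rfl | rfl <;> simp [path]
    · obtain ⟨y, hy, hyx, hxy⟩ := hdR e x he
      refine ⟨y, (hcinner y e hy).trans hyx, hxy, fun e' he' => ?_,
        fun a ha => (M.base_notMem_inner a e (ha ▸ he)).elim⟩
      have : e = e' := by
        rcases M.mem_path.1 he' with rfl | h | rfl
        · exact (M.base_notMem_inner _ _ he).elim
        · exact M.eq_of_mem_inner he h
        · exact (M.base_notMem_inner _ _ he).elim
      subst this
      exact N.mem_path.2 (Or.inr (Or.inl hy))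
  choose φ hcφ hφle hφpath hφbase using hφ
  have hconn : ∀ y, Relation.ReflTransGen (fun a b => B.graph.Adj a b ∧ c a = c b) (φ (c y)) y := by
    intro y
    have hpath : ∀ e, y ∈ N.path e →
        Relation.ReflTransGen (fun a b => B.graph.Adj a b ∧ c a = c b) (φ (c y)) y := by
      intro e hy
      exact Relation.ReflTransGen.mono (fun a b h => ⟨(hNadj a b).2 ⟨e, h.1⟩, h.2⟩) _ _
        ((hcol e).reflTransGen (M.nodup_path hne e) (hφpath _ e ((hcol e).mem y hy)) hy (hcφ _))
    rcases N.cover y with ⟨a, rfl⟩ | ⟨e, he⟩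
    · rw [hφbase _ a (hcbase a)]
    · exact hpath e (N.mem_path.2 (Or.inr (Or.inl he)))
  refine ⟨fun x => Finset.univ.filter fun y => c y = x, fun x => ⟨φ x, by simp [hcφ]⟩, ?_,
    fun y => ⟨c y, by simp⟩, ?_, ?_, fun x => (hφle x).labelUnion (by simp [hcφ])⟩
  · intro a b hab
    rw [Finset.disjoint_left]
    intro y hy hy'
    simp only [Finset.mem_filter, Finset.mem_univ, true_and] at hy hy'
    exact hab (hy.symm.trans hy')
  · intro x
    rw [SimpleGraph.connected_iff_exists_forall_reachable]
    refine ⟨⟨φ x, by simp [hcφ]⟩, ?_⟩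
    rintro ⟨y, hy⟩
    have hyx : c y = x := by simpa using hy
    subst hyx
    exact reachable_induce_of_reflTransGen (x := c y) (by simp) (hconn y) _ _
  · intro a b hab
    simp only [Finset.mem_filter, Finset.mem_univ, true_and]
    constructor
    · rintro ⟨y, rfl, z, rfl, hyz⟩
      obtain ⟨e, he⟩ := (hNadj y z).1 hyz
      refine (hMadj _ _).2 ⟨e, he.imp (fun h => ?_) (fun h => ?_)⟩
      · exact ((hcol e).eq_or_consec h).resolve_left hab
      · exact ((hcol e).eq_or_consec h).resolve_left hab.symm
    · intro h
      obtain ⟨e, he | he⟩ := (hMadj a b).1 h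
      · obtain ⟨y, z, hyz, hy, hz⟩ := (hcol e).exists_consec he
        exact ⟨y, hy, z, hz, (hNadj y z).2 ⟨e, Or.inl hyz⟩⟩
      · obtain ⟨y, z, hyz, hy, hz⟩ := (hcol e).exists_consec he
        exact ⟨z, hz, y, hy, (hNadj z y).2 ⟨e, Or.inr hyz⟩⟩

end Models

theorem wellQuasiOrdered_sublistForall₂ {α : Type*} {r : α → α → Prop} [IsPreorder α r]
    (h : WellQuasiOrdered r) : WellQuasiOrdered (List.SublistForall₂ r) := by
  have := Set.PartiallyWellOrderedOn.partiallyWellOrderedOn_sublistForall₂ r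
    (Set.partiallyWellOrderedOn_univ_iff.2 h)
  simpa [Set.partiallyWellOrderedOn_univ_iff] using this

/-- For every wqo `(S, ≤)` and every finite graph `G`, the `(S, ≤)`-labeled
subdivisions of `G` are well-quasi-ordered by the label-respecting contraction
relation. -/
theorem labeled_subdivisions_wqo_contraction {α : Type*} [Fintype α]
    (G : SimpleGraph α) {S : Type*} [Preorder S]
    (hwqo : IsWqo ((· ≤ ·) : S → S → Prop))
    (f : ℕ → LabGraph S) (hf : ∀ i, IsSubdivision (f i).graph G) :
    ∃ i j, i < j ∧ LabContraction (· ≤ ·) (f i) (f j) := by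
  classical
  let enc := Fintype.equivFin α
  let E := {p : α × α // G.Adj p.1 p.2 ∧ enc p.1 < enc p.2}
  let src : E → α := fun e => e.1.1
  let tgt : E → α := fun e => e.1.2
  have hne : ∀ e, src e ≠ tgt e := fun e => e.2.1.ne
  have hE : ∀ e e', (src e = src e' ∧ tgt e = tgt e') ∨ (src e = tgt e' ∧ tgt e = src e') →
      e = e' := by
    rintro ⟨⟨a, b⟩, hab, hlt⟩ ⟨⟨a', b'⟩, hab', hlt'⟩ (⟨h, h'⟩ | ⟨h, h'⟩)
    · exact Subtype.ext (Prod.ext h h')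
    · simp only [src, tgt] at h h' hlt hlt'
      subst h h'
      exact (lt_asymm hlt hlt').elim
  have hG : ∀ a b, G.Adj a b ↔ ∃ e, (src e = a ∧ tgt e = b) ∨ (src e = b ∧ tgt e = a) := by
    intro a b
    constructor
    · intro h
      rcases lt_or_gt_of_ne (enc.injective.ne h.ne) with hlt | hlt
      · exact ⟨⟨(a, b), h, hlt⟩, Or.inl ⟨rfl, rfl⟩⟩
      · exact ⟨⟨(b, a), h.symm, hlt⟩, Or.inr ⟨rfl, rfl⟩⟩
    · rintro ⟨e, ⟨rfl, rfl⟩ | ⟨rfl, rfl⟩⟩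
      · exact e.2.1
      · exact e.2.1.symm
  have M := fun i => Classical.choice (SubdivModel.of_isSubdivision hne hE hG (hf i))
  have hlab : WellQuasiOrdered (List.SublistForall₂ ((· ≤ ·) : S → S → Prop)) :=
    wellQuasiOrdered_sublistForall₂ hwqo
  have : IsPreorder (List S) (List.SublistForall₂ ((· ≤ ·) : S → S → Prop)) := {}
  have : IsPreorder (List (List S))
    (List.SublistForall₂ (List.SublistForall₂ ((· ≤ ·) : S → S → Prop))) := {}
  have hbase := WellQuasiOrdered.pi (ι := α) fun _ => hlab
  have hinner := WellQuasiOrdered.pi (ι := E) fun _ => wellQuasiOrdered_sublistForall₂ hlab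
  have : IsPreorder (α → List S)
      (fun a b => ∀ i, List.SublistForall₂ ((· ≤ ·) : S → S → Prop) (a i) (b i)) :=
    { refl := fun a i => refl (a i)
      trans := fun a b c hab hbc i => _root_.trans (hab i) (hbc i) }
  obtain ⟨i, j, hij, h, h'⟩ := hbase.prod hinner fun i =>
    (fun a => ((f i).label ((M i).base a)).toList,
      fun e => ((M i).inner e).map fun x => ((f i).label x).toList)
  refine ⟨i, j, hij, (M i).labContraction (M j) hne
    (fun a => finsetLE_of_sublistForall₂ (h a)) fun e => ?_⟩
  have he := h' e
  simp only [List.sublistForall₂_map_left_iff, List.sublistForall₂_map_right_iff] at he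
  obtain ⟨l, hl, hl'⟩ := List.sublistForall₂_iff.1 he
  exact List.sublistForall₂_iff.2
    ⟨l, hl.imp fun _ _ hxy => finsetLE_of_sublistForall₂ hxy, hl'⟩

end IMWQO
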